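/- For every N ≥ 2 there exists a constant τ_N ∈ (0, 1] such that for every automorphism φ of F_N: τ_N·Λ_A(φ) ≤ liminf_{n→∞} avg_n(φ), and avg_n(φ) ≤ Λ_A(φ) for every n ≥ 1. In particular, 0 < τ_N ≤ λ_A(φ)/Λ_A(φ) ≤ 1 for every automorphism φ of F_N. -/

import Mathlib

/-- The reduced word length of an element of the free group on `Fin N`. -/
noncomputable def wlen {N : ℕ} (w : FreeGroup (Fin N)) : ℕ := w.toWord.length

/-- The cyclically reduced length of `w`: the minimal word length among all conjugates. -/
noncomputable def cyclen {N : ℕ} (w : FreeGroup (Fin N)) : ℕ :=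
  sInf (Set.range fun g : FreeGroup (Fin N) => wlen (g * w * g⁻¹))

/-- The extremal stretching factor: `sup_{w ≠ 1} ‖φ w‖_A / ‖w‖_A`. -/
noncomputable def LambdaA {N : ℕ} (φ : FreeGroup (Fin N) → FreeGroup (Fin N)) : ℝ :=
  ⨆ w : {w : FreeGroup (Fin N) // w ≠ 1}, (cyclen (φ w.1) : ℝ) / (cyclen w.1 : ℝ)

/-- The average of `‖φ w‖_A` over the (finite) sphere of radius `n` in `F_N`,
divided by `n`: `avg_n(φ) = (Σ_{|w|=n} ‖φ(w)‖_A) / (n · 2N(2N−1)^{n−1})`. -/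
noncomputable def avg (N : ℕ) (φ : FreeGroup (Fin N) → FreeGroup (Fin N)) (n : ℕ) : ℝ :=
  (∑' w : {w : FreeGroup (Fin N) // wlen w = n}, (cyclen (φ w.1) : ℝ)) /
    ((n : ℝ) * ((2 * N * (2 * N - 1) ^ (n - 1) : ℕ) : ℝ))

/-- The generic stretching factor `λ_A(φ) = limsup_n avg_n(φ)`. -/
noncomputable def lamA (N : ℕ) (φ : FreeGroup (Fin N) → FreeGroup (Fin N)) : ℝ :=
  Filter.limsup (avg N φ) Filter.atTop

/-- The length of the longest common prefix of two lists. -/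
def List.lcpLength {β : Type*} [DecidableEq β] : List β → List β → ℕ
  | a :: l, b :: m => if a = b then lcpLength l m + 1 else 0
  | _, _ => 0

namespace List

variable {β : Type*} [DecidableEq β]

theorem lcpLength_comm (l m : List β) : lcpLength l m = lcpLength m l := by
  induction l generalizing m with
  | nil => cases m <;> simp [lcpLength]
  | cons a l ih =>
    cases m with
    | nil => simp [lcpLength]
    | cons b m => simp [lcpLength, ih m, eq_comm]

theorem lcpLength_le_left (l m : List β) : lcpLength l m ≤ l.length := by
  induction l generalizing m with
  | nil => cases m <;> simp [lcpLength]
  | cons a l ih =>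
    cases m with
    | nil => simp [lcpLength]
    | cons b m =>
      have := ih m
      simp only [lcpLength, length_cons]
      split_ifs <;> omega

theorem min_lcpLength_le (l m n : List β) :
    min (lcpLength l m) (lcpLength m n) ≤ lcpLength l n := by
  induction l generalizing m n with
  | nil => cases m <;> simp [lcpLength]
  | cons a l ih =>
    cases m with
    | nil => simp [lcpLength]
    | cons b m =>
      cases n with
      | nil => simp [lcpLength]
      | cons c n =>
        have := ih m n
        simp only [lcpLength]
        split_ifs <;> simp_all

theorem take_eq_take_of_le_lcpLength {l m : List β} {n : ℕ} (h : n ≤ lcpLength l m) :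
    l.take n = m.take n := by
  induction l generalizing m n with
  | nil => cases m <;> simp_all [lcpLength]
  | cons a l ih =>
    cases m with
    | nil => simp_all [lcpLength]
    | cons b m =>
      cases n with
      | zero => simp
      | succ n =>
        simp only [lcpLength] at h
        split_ifs at h with hab
        · simp [hab, ih (Nat.le_of_succ_le_succ h)]
        · omega

theorem lcpLength_self_append (l t : List β) : lcpLength l (l ++ t) = l.length := by
  induction l with
  | nil => cases t <;> simp [lcpLength]
  | cons a l ih => simp [lcpLength, ih]

end List

namespace FreeGroup

variable {α : Type*} [DecidableEq α]

theorem norm_mk_of_isReduced {l : List (α × Bool)} (h : IsReduced l) : norm (mk l) = l.length := by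
  rw [norm, toWord_mk, h.reduce_eq]

theorem isReduced_invRev {l : List (α × Bool)} (h : IsReduced l) : IsReduced (invRev l) := by
  rw [isReduced_iff_reduce_eq, reduce_invRev, h.reduce_eq]

theorem norm_inv_mk_mul_mk {l m : List (α × Bool)} (hl : IsReduced l) (hm : IsReduced m) :
    norm ((mk l)⁻¹ * mk m) + 2 * l.lcpLength m = l.length + m.length := by
  induction l generalizing m with
  | nil => cases m <;> simp [List.lcpLength, ← one_eq_mk, norm_mk_of_isReduced hm]
  | cons a l ih =>
    cases m with
    | nil =>
      have : norm (mk (a :: l))⁻¹ = (a :: l).length := by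
        rw [norm_inv_eq, norm_mk_of_isReduced hl]
      simpa [List.lcpLength, ← one_eq_mk] using this
    | cons b m =>
      simp only [List.lcpLength, List.length_cons]
      split_ifs with hab
      · subst hab
        have := ih (m := m) (List.IsChain.tail hl) (List.IsChain.tail hm)
        have e : (mk (a :: l))⁻¹ * mk (a :: m) = (mk l)⁻¹ * mk m := by
          rw [← List.singleton_append, ← List.singleton_append (l := m), ← mul_mk, ← mul_mk]
          group
        rw [e]
        omega
      · have hred : IsReduced (invRev (a :: l) ++ (b :: m)) := by
          have h1 := isReduced_invRev hl
          rw [IsReduced, List.isChain_append]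
          refine ⟨h1, hm, ?_⟩
          intro x hx y hy
          simp [invRev] at hx hy
          subst hx hy
          intro h
          by_contra h'
          apply hab
          ext
          · exact h
          · simp only at h'
            revert h'
            cases a.2 <;> cases b.2 <;> simp
        rw [inv_mk, mul_mk, norm_mk_of_isReduced hred]
        simp

/-- The length of the longest common prefix of the reduced words of two elements: the Gromov
product based at `1` in the Cayley tree. -/
def lcp (u v : FreeGroup α) : ℕ := u.toWord.lcpLength v.toWord

theorem norm_inv_mul_add (u v : FreeGroup α) :
    norm (u⁻¹ * v) + 2 * lcp u v = norm u + norm v := by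
  have := norm_inv_mk_mul_mk (isReduced_toWord (x := u)) (isReduced_toWord (x := v))
  rwa [mk_toWord, mk_toWord] at this

theorem lcp_comm (u v : FreeGroup α) : lcp u v = lcp v u := List.lcpLength_comm _ _

theorem lcp_le_norm_left (u v : FreeGroup α) : lcp u v ≤ norm u := List.lcpLength_le_left _ _

theorem lcp_le_norm_right (u v : FreeGroup α) : lcp u v ≤ norm v := by
  rw [lcp_comm]
  exact lcp_le_norm_left _ _

theorem min_lcp_le (u v w : FreeGroup α) : min (lcp u v) (lcp v w) ≤ lcp u w :=
  List.min_lcpLength_le _ _ _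

theorem lcp_one_left (u : FreeGroup α) : lcp 1 u = 0 := by
  simpa using lcp_le_norm_left 1 u

/-- Change of base point in Gromov products. -/
theorem lcp_inv_mul_inv (g x : FreeGroup α) : lcp (g⁻¹ * x) g⁻¹ + lcp x g = norm g := by
  have h1 := norm_inv_mul_add (g⁻¹ * x) g⁻¹
  have h2 := norm_inv_mul_add x g
  have e1 : (g⁻¹ * x)⁻¹ * g⁻¹ = x⁻¹ := by group
  have e2 : norm (g⁻¹ * x) = norm (x⁻¹ * g) := by
    rw [← norm_inv_eq]
    congr 1
    group
  rw [e1, norm_inv_eq, norm_inv_eq, e2] at h1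
  omega

theorem norm_mul_le_norm_add (g h : FreeGroup α) : norm g ≤ norm (g * h) + norm h := by
  have := norm_mul_le (g * h) h⁻¹
  simpa [norm_inv_eq] using this

/-! ### Cyclic reduction -/

open reduceCyclically in
/-- Normal form of the powers of an element. -/
theorem exists_toWord_pow (g : FreeGroup α) : ∃ r s : List (α × Bool),
    g = mk r * mk s * (mk r)⁻¹ ∧
    ∀ k : ℕ, (g ^ (k + 1)).toWord = r ++ (List.replicate (k + 1) s).flatten ++ invRev r := by
  refine ⟨conjugator g.toWord, reduceCyclically g.toWord, ?_, fun k => ?_⟩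
  · rw [inv_mk, mul_mk, mul_mk, conj_conjugator_reduceCyclically, mk_toWord]
  · rw [toWord_pow, reduce_flatten_replicate_succ isReduced_toWord]

theorem norm_le_norm_sq (g : FreeGroup α) : norm g ≤ norm (g * g) := by
  obtain ⟨r, s, -, h⟩ := exists_toWord_pow g
  have h0 := congrArg List.length (h 0)
  have h1 := congrArg List.length (h 1)
  simp only [zero_add, pow_one, List.length_append, List.length_flatten, List.map_replicate,
    List.sum_replicate, invRev_length, smul_eq_mul] at h0 h1
  have : g * g = g ^ (1 + 1) := by rw [pow_succ, pow_one]
  rw [this, norm, norm]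
  omega

/-- If a large power of `g⁻¹` brings `x` close to `1`, then `g` translates a long initial segment
of the geodesic from `1` to `x` along itself. -/
theorem exists_translation {g x : FreeGroup α} {k D : ℕ} (hg : norm g ≤ 3 * D)
    (hx : norm ((g ^ (k + 1))⁻¹ * x) + 12 * D ≤ norm x) :
    ∃ s ≤ 3 * D, ∀ t, 2 * D ≤ t → t + s ≤ 9 * D →
      g * mk (x.toWord.take t) = mk (x.toWord.take (t + s)) := by
  obtain ⟨r, s, hgrs, h⟩ := exists_toWord_pow g
  have h0 := congrArg List.length (h 0)
  have h1 := congrArg List.length (h k)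
  simp only [zero_add, pow_one, List.length_append, List.length_flatten, List.map_replicate,
    List.sum_replicate, invRev_length, smul_eq_mul] at h0 h1
  rw [norm] at hg
  have h2 := norm_inv_mul_add (g ^ (k + 1)) x
  have h3 : norm (g ^ (k + 1)) = (g ^ (k + 1)).toWord.length := rfl
  refine ⟨s.length, by omega, fun t ht hts => ?_⟩
  have key : ∀ n ≤ 9 * D, x.toWord.take n =
      (r ++ (List.replicate (k + 1) s).flatten).take n := by
    intro n hn
    have h4 : n ≤ lcp (g ^ (k + 1)) x := by
      have := lcp_le_norm_right (g ^ (k + 1)) x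
      have := norm_mul_le (g ^ (k + 1)) ((g ^ (k + 1))⁻¹ * x)
      rw [mul_inv_cancel_left] at this
      omega
    rw [← List.take_eq_take_of_le_lcpLength h4, h k, List.take_append_of_le_length]
    simp only [List.length_append, List.length_flatten, List.map_replicate,
      List.sum_replicate, smul_eq_mul]
    have := norm_mul_le (g ^ (k + 1)) ((g ^ (k + 1))⁻¹ * x)
    rw [mul_inv_cancel_left] at this
    omega
  have hk : t - r.length + s.length ≤ (List.replicate (k + 1) s).flatten.length := by
    simp only [List.length_flatten, List.map_replicate,
      List.sum_replicate, smul_eq_mul]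
    have := norm_mul_le (g ^ (k + 1)) ((g ^ (k + 1))⁻¹ * x)
    rw [mul_inv_cancel_left] at this
    omega
  rw [key t (by omega), key (t + s.length) (by omega), List.take_append, List.take_append,
    List.take_of_length_le (show r.length ≤ t by omega),
    List.take_of_length_le (show r.length ≤ t + s.length by omega), hgrs]
  have e : (List.replicate (k + 1) s).flatten.take (t + s.length - r.length) =
      s ++ (List.replicate (k + 1) s).flatten.take (t - r.length) := by
    have e1 : t + s.length - r.length = s.length + (t - r.length) := by omega
    have e2 : s ++ (List.replicate (k + 1) s).flatten =
        (List.replicate (k + 1) s).flatten ++ s := by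
      rw [← List.flatten_cons, ← List.replicate_succ, List.replicate_succ', List.flatten_concat]
    rw [e1, ← List.take_append_of_le_length (l₂ := s) (i := s.length + (t - r.length)) (by omega),
      ← e2, List.take_append]
    simp
  rw [e, ← mul_mk, ← mul_mk, ← mul_mk]
  group

theorem commute_of_translations {g h x : FreeGroup α} {k D : ℕ} (hg : norm g ≤ 3 * D)
    (hh : norm h ≤ 3 * D) (hgx : norm ((g ^ (k + 1))⁻¹ * x) + 12 * D ≤ norm x)
    (hhx : norm ((h ^ (k + 1))⁻¹ * x) + 12 * D ≤ norm x) : g * h = h * g := by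
  obtain ⟨s, hs, Hg⟩ := exists_translation hg hgx
  obtain ⟨s', hs', Hh⟩ := exists_translation hh hhx
  have e1 : g * h * mk (x.toWord.take (2 * D)) = mk (x.toWord.take (2 * D + s' + s)) := by
    rw [mul_assoc, Hh _ le_rfl (by omega), Hg _ (by omega) (by omega)]
  have e2 : h * g * mk (x.toWord.take (2 * D)) = mk (x.toWord.take (2 * D + s' + s)) := by
    rw [mul_assoc, Hg _ le_rfl (by omega), Hh _ (by omega) (by omega)]
    congr 2
    omega
  exact mul_right_cancel (e1.trans e2.symm)

end FreeGroup

namespace FreeGroup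

variable {α ι : Type*} [DecidableEq α]

theorem lcp_le_lcp_mul_self {e h : FreeGroup α} (he : norm e = 1) : lcp e h ≤ lcp e (h * e) := by
  have h1 := lcp_le_norm_left e h
  have h2 := norm_inv_mul_add h (h * e)
  rw [inv_mul_cancel_left] at h2
  have h3 := norm_mul_le_norm_add h e
  have h4 := min_lcp_le e h (h * e)
  have h5 := norm_inv_mul_add e h
  by_cases hn : 2 ≤ norm h
  · omega
  · by_cases hz : lcp e h = 0
    · omega
    · have h6 := lcp_le_norm_right e h
      have h7 : norm (e⁻¹ * h) = 0 := by omega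
      rw [norm_eq_zero, inv_mul_eq_one] at h7
      subst h7
      have := norm_le_norm_sq e
      omega

theorem norm_conj_letter_le {e : FreeGroup α} (he : norm e = 1) (g : FreeGroup α) :
    norm (e⁻¹ * g * e) + 2 * lcp e g + 2 * lcp e g⁻¹ ≤ norm g + 2 := by
  have h1 := norm_inv_mul_add e g
  have h2 := norm_inv_mul_add e (g⁻¹ * e)
  have h3 := lcp_le_lcp_mul_self (h := g⁻¹) he
  have e1 : norm (e⁻¹ * g * e) = norm (e⁻¹ * (g⁻¹ * e)) := by
    rw [← norm_inv_eq]
    congr 1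
    group
  have e2 : norm (e⁻¹ * g) = norm (g⁻¹ * e) := by
    rw [← norm_inv_eq]
    congr 1
    group
  omega

theorem exists_letter_lcp {x : FreeGroup α} (hx : x ≠ 1) : ∃ e, norm e = 1 ∧ lcp e x = 1 := by
  rcases h : x.toWord with _ | ⟨a, l⟩
  · exact absurd (toWord_eq_nil_iff.1 h) hx
  · have ha : (mk [a]).toWord = [a] := by rw [toWord_mk, IsReduced.singleton.reduce_eq]
    refine ⟨mk [a], by simp [norm, ha], ?_⟩
    rw [lcp, ha, h]
    simp [List.lcpLength]

/-- No conjugation by a single letter decreases the energy `∑ ‖g i‖²`. -/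
def IsEnergyMinimal [Fintype ι] (g : ι → FreeGroup α) : Prop :=
  ∀ e : FreeGroup α, norm e = 1 → ∑ i, norm (g i) ^ 2 ≤ ∑ i, norm (e⁻¹ * g i * e) ^ 2

theorem IsEnergyMinimal.sum_le [Fintype ι] {g : ι → FreeGroup α} (hg : IsEnergyMinimal g)
    {e : FreeGroup α} (he : norm e = 1) :
    ∑ i, (norm (g i) : ℤ) * (lcp e (g i) + lcp e (g i)⁻¹ - 1) ≤ Fintype.card ι := by
  have h0 : (∑ i, (norm (g i) : ℤ) ^ 2) ≤ ∑ i, (norm (e⁻¹ * g i * e) : ℤ) ^ 2 := by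
    exact_mod_cast hg e he
  have h1 : ∀ i, (norm (e⁻¹ * g i * e) : ℤ) ^ 2 ≤ (norm (g i) : ℤ) ^ 2 -
      4 * ((norm (g i) : ℤ) * (lcp e (g i) + lcp e (g i)⁻¹ - 1)) + 4 := by
    intro i
    have a1 := norm_conj_letter_le he (g i)
    have a2 := lcp_le_norm_left e (g i)
    have a3 := lcp_le_norm_left e (g i)⁻¹
    rw [he] at a2 a3
    generalize norm (e⁻¹ * g i * e) = d' at *
    generalize norm (g i) = d at *
    generalize lcp e (g i) = s at *
    generalize lcp e (g i)⁻¹ = t at *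
    have b1 : (d' : ℤ) ≤ d + 2 - 2 * s - 2 * t := by omega
    have b2 : (d' : ℤ) ^ 2 ≤ (d + 2 - 2 * s - 2 * t) ^ 2 := pow_le_pow_left₀ (by positivity) b1 2
    have b3 : ((s : ℤ) + t - 1) ^ 2 ≤ 1 := by
      rw [sq_le_one_iff_abs_le_one, abs_le]
      omega
    nlinarith
  have h2 := h0.trans (Finset.sum_le_sum fun i _ => h1 i)
  simp only [Finset.sum_add_distrib, Finset.sum_sub_distrib, ← Finset.mul_sum, Finset.sum_const,
    Finset.card_univ, nsmul_eq_mul] at h2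
  linarith

/-- The total increment of the distance to `x` when moving from `1` to the points `(g i)^{±1}`. -/
def drift [Fintype ι] (g : ι → FreeGroup α) (x : FreeGroup α) : ℤ :=
  ∑ i, ((norm (x⁻¹ * g i) : ℤ) + norm (x⁻¹ * (g i)⁻¹) - 2 * norm x)

theorem drift_eq [Fintype ι] (g : ι → FreeGroup α) (x : FreeGroup α) :
    drift g x = ∑ i, (2 * (norm (g i) : ℤ) - 2 * lcp x (g i) - 2 * lcp x (g i)⁻¹) := by
  refine Finset.sum_congr rfl fun i _ => ?_
  have h1 := norm_inv_mul_add x (g i)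
  have h2 := norm_inv_mul_add x (g i)⁻¹
  rw [norm_inv_eq] at h2
  omega

theorem drift_one [Fintype ι] (g : ι → FreeGroup α) :
    drift g 1 = ∑ i, 2 * (norm (g i) : ℤ) := by
  simp [drift_eq, lcp_one_left]

theorem drift_eq_add [Fintype ι] (g : ι → FreeGroup α) (x e : FreeGroup α) :
    drift g x = -2 * ∑ i, (norm (g i) : ℤ) * (lcp e (g i) + lcp e (g i)⁻¹ - 1) +
      2 * ∑ i, ((lcp e (g i) * norm (g i) - lcp x (g i) : ℤ) +
        (lcp e (g i)⁻¹ * norm (g i) - lcp x (g i)⁻¹)) := by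
  rw [drift_eq, Finset.mul_sum, Finset.mul_sum, ← Finset.sum_add_distrib]
  refine Finset.sum_congr rfl fun i _ => ?_
  ring

theorem lcp_le_mul_of_letter {x e v : FreeGroup α} (hx : lcp e x = 1) :
    (lcp x v : ℤ) ≤ lcp e v * norm v := by
  have h1 := min_lcp_le e x v
  have h2 := lcp_le_norm_right x v
  rcases Nat.eq_zero_or_pos (lcp e v) with h | h
  · have : lcp x v = 0 := by omega
    simp [this, h]
  · have : lcp x v ≤ lcp e v * norm v := h2.trans (Nat.le_mul_of_pos_left _ h)
    exact_mod_cast this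

theorem defect_nonneg {x e : FreeGroup α} (hx : lcp e x = 1) (g : FreeGroup α) :
    (0 : ℤ) ≤ lcp e g * norm g - lcp x g ∧ (0 : ℤ) ≤ lcp e g⁻¹ * norm g - lcp x g⁻¹ := by
  have h1 := lcp_le_mul_of_letter hx (v := g)
  have h2 := lcp_le_mul_of_letter hx (v := g⁻¹)
  rw [norm_inv_eq] at h2
  constructor <;> linarith

theorem IsEnergyMinimal.neg_le_drift [Fintype ι] {g : ι → FreeGroup α} (hg : IsEnergyMinimal g)
    (x : FreeGroup α) : -(2 * Fintype.card ι : ℤ) ≤ drift g x := by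
  by_cases hx : x = 1
  · rw [hx, drift_one]
    have : (0 : ℤ) ≤ ∑ i, 2 * (norm (g i) : ℤ) := Finset.sum_nonneg fun i _ => by positivity
    omega
  · obtain ⟨e, he, hex⟩ := exists_letter_lcp hx
    rw [drift_eq_add g x e]
    have h1 := hg.sum_le he
    have h2 : (0 : ℤ) ≤ ∑ i, ((lcp e (g i) * norm (g i) - lcp x (g i) : ℤ) +
        (lcp e (g i)⁻¹ * norm (g i) - lcp x (g i)⁻¹)) :=
      Finset.sum_nonneg fun i _ => add_nonneg (defect_nonneg hex _).1 (defect_nonneg hex _).2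
    linarith

/-- Where the drift towards `x` is small, exactly one of `g b` and `(g b)⁻¹` points towards `x`, and
it fellow travels with `x`. -/
theorem IsEnergyMinimal.dichotomy [Fintype ι] {g : ι → FreeGroup α} (hg : IsEnergyMinimal g)
    {x : FreeGroup α} {E : ℕ} (hE : 2 * Fintype.card ι ≤ E) (b : ι)
    (hb : 8 * Fintype.card ι * E ≤ norm (g b)) (hx : drift g x ≤ E) :
    (norm (g b) ≤ lcp x (g b) + E ∧ lcp x (g b)⁻¹ = 0) ∨
      (norm (g b) ≤ lcp x (g b)⁻¹ + E ∧ lcp x (g b) = 0) := by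
  classical
  have hN : 1 ≤ Fintype.card ι := Fintype.card_pos_iff.2 ⟨b⟩
  have hEN : E ≤ Fintype.card ι * E := Nat.le_mul_of_pos_left _ hN
  rw [mul_assoc] at hb
  by_cases hx1 : x = 1
  · rw [hx1, drift_one] at hx
    have := Finset.single_le_sum (f := fun i => 2 * (norm (g i) : ℤ))
      (fun i _ => by positivity) (Finset.mem_univ b)
    omega
  obtain ⟨e, he, hex⟩ := exists_letter_lcp hx1
  have h1 := hg.sum_le he
  have hd := drift_eq_add g x e
  set T := ∑ i, ((lcp e (g i) * norm (g i) - lcp x (g i) : ℤ) +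
        (lcp e (g i)⁻¹ * norm (g i) - lcp x (g i)⁻¹)) with hT
  have hTE : T ≤ E := by omega
  have hdef : ∀ i, (lcp e (g i) * norm (g i) - lcp x (g i) : ℤ) ≤ E ∧
      (lcp e (g i)⁻¹ * norm (g i) - lcp x (g i)⁻¹ : ℤ) ≤ E := by
    intro i
    have a := Finset.single_le_sum (f := fun i => (lcp e (g i) * norm (g i) - lcp x (g i) : ℤ) +
        (lcp e (g i)⁻¹ * norm (g i) - lcp x (g i)⁻¹))
      (fun i _ => add_nonneg (defect_nonneg hex _).1 (defect_nonneg hex _).2) (Finset.mem_univ i)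
    have a' := defect_nonneg hex (g i)
    rw [← hT] at a
    constructor <;> linarith [a'.1, a'.2]
  have hT0 : 0 ≤ T :=
    Finset.sum_nonneg fun i _ => add_nonneg (defect_nonneg hex _).1 (defect_nonneg hex _).2
  have ht : ∀ v, lcp e v ≤ 1 := fun v => he ▸ lcp_le_norm_left e v
  have hboth : ∀ i, lcp e (g i) = 1 → lcp e (g i)⁻¹ = 1 → norm (g i) ≤ 2 * E := by
    intro i h h'
    have a := hdef i
    rw [h, h'] at a
    have b1 := norm_inv_mul_add (g i)⁻¹ (g i)
    have b2 := min_lcp_le (g i)⁻¹ x (g i)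
    rw [inv_inv, norm_inv_eq] at b1
    rw [lcp_comm _ x] at b2
    have b3 := norm_le_norm_sq (g i)
    omega
  have hpos : ¬ (lcp e (g b) = 0 ∧ lcp e (g b)⁻¹ = 0) := by
    rintro ⟨h, h'⟩
    have hle : ∀ i ∈ Finset.univ, (norm (g i) : ℤ) * (lcp e (g i) + lcp e (g i)⁻¹ - 1) ≤
        2 * E - if i = b then (norm (g b) : ℤ) else 0 := by
      intro i _
      split_ifs with hi
      · subst hi
        rw [h, h']
        push_cast
        linarith [Int.natCast_nonneg E]
      · have t1 := ht (g i)
        have t2 := ht (g i)⁻¹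
        have t3 := hboth i
        interval_cases h5 : lcp e (g i) <;> interval_cases h6 : lcp e (g i)⁻¹ <;>
          simp at t3 ⊢ <;> omega
    have hs := Finset.sum_le_sum hle
    simp only [Finset.sum_sub_distrib, Finset.sum_const, Finset.card_univ, nsmul_eq_mul,
      Finset.sum_ite_eq', Finset.mem_univ, if_true] at hs
    have : (8 * (Fintype.card ι * E) : ℤ) ≤ norm (g b) := by exact_mod_cast hb
    have : (E : ℤ) ≤ Fintype.card ι * E := by exact_mod_cast hEN
    nlinarith
  have t1 := ht (g b)
  have t2 := ht (g b)⁻¹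
  have t3 := hboth b
  have d1 := hdef b
  have d2 := defect_nonneg hex (g b)
  interval_cases h5 : lcp e (g b) <;> interval_cases h6 : lcp e (g b)⁻¹ <;>
    simp only [Nat.cast_zero, Nat.cast_one, zero_mul, one_mul, zero_ne_one, one_ne_zero, and_self,
      and_true, and_false, not_true, true_imp_iff, false_imp_iff] at t3 d1 d2 hpos <;> omega

theorem norm_inv_pow_mul_add_le {β y : FreeGroup α} {k E : ℕ} (hE : 2 * E < norm β)
    (h0 : norm β ≤ lcp y β + E)
    (h : ∀ j ≤ k, (norm β ≤ lcp ((β ^ j)⁻¹ * y) β + E ∧ lcp ((β ^ j)⁻¹ * y) β⁻¹ = 0) ∨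
      (norm β ≤ lcp ((β ^ j)⁻¹ * y) β⁻¹ + E ∧ lcp ((β ^ j)⁻¹ * y) β = 0)) :
    norm ((β ^ (k + 1))⁻¹ * y) + (k + 1) * norm β ≤ norm y + (k + 1) * (2 * E) := by
  have e : ∀ j, (β ^ (j + 1))⁻¹ * y = β⁻¹ * ((β ^ j)⁻¹ * y) := fun j => by
    rw [pow_succ, mul_inv_rev, mul_assoc]
  have step : ∀ j, norm β ≤ lcp ((β ^ j)⁻¹ * y) β + E →
      norm ((β ^ (j + 1))⁻¹ * y) + norm β ≤ norm ((β ^ j)⁻¹ * y) + 2 * E := by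
    intro j hj
    have := norm_inv_mul_add β ((β ^ j)⁻¹ * y)
    rw [lcp_comm] at this
    rw [e]
    omega
  have fwd : ∀ j ≤ k, norm β ≤ lcp ((β ^ j)⁻¹ * y) β + E := by
    intro j
    induction j with
    | zero => simpa using h0
    | succ j ih =>
      intro hj
      rcases h (j + 1) hj with h' | h'
      · exact h'.1
      · have h1 := ih (by omega)
        have h2 := lcp_inv_mul_inv β ((β ^ j)⁻¹ * y)
        rw [← e] at h2
        omega
  have total : ∀ j ≤ k, norm ((β ^ (j + 1))⁻¹ * y) + (j + 1) * norm β ≤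
      norm y + (j + 1) * (2 * E) := by
    intro j
    induction j with
    | zero =>
      intro _
      have := step 0 (by simpa using h0)
      simp only [zero_add, pow_zero, inv_one, one_mul] at this ⊢
      exact this
    | succ j ih =>
      intro hj
      have h1 := ih (by omega)
      have h2 := step (j + 1) (fwd (j + 1) hj)
      nlinarith
  exact total k le_rfl

theorem not_commute_of {b c : ι} (hbc : c ≠ b) {s s' : FreeGroup ι}
    (hs : s = of b ∨ s = (of b)⁻¹) (hs' : s' = of b ∨ s' = (of b)⁻¹) :
    s * (of c * s' * (of c)⁻¹) ≠ of c * s' * (of c)⁻¹ * s := by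
  classical
  intro h
  let f : FreeGroup ι →* Equiv.Perm (Fin 3) :=
    lift fun i => if i = b then Equiv.swap 0 1 else Equiv.swap 0 2
  have hb : f (of b) = Equiv.swap 0 1 := by simp [f]
  have hc : f (of c) = Equiv.swap 0 2 := by simp [f, hbc]
  have h' := congrArg f h
  rcases hs with rfl | rfl <;> rcases hs' with rfl | rfl <;>
    simp only [_root_.map_mul, _root_.map_inv, hb, hc] at h' <;> revert h' <;> decide

theorem norm_of_pow_inv_le [DecidableEq ι] (b : ι) (j : ℕ) : norm (((of b)⁻¹ ^ j)) ≤ j := by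
  rw [inv_pow, norm_inv_eq, norm_of_pow]

/-- Near every point there is a place with definite drift away from `x`. -/
theorem IsEnergyMinimal.exists_lt_drift [Fintype ι] [DecidableEq ι]
    {ρ : FreeGroup ι →* FreeGroup α} (hρ : Function.Injective ρ)
    (hg : IsEnergyMinimal fun i => ρ (of i)) {b c : ι} (hbc : c ≠ b)
    (hc : norm (ρ (of c)) ≤ norm (ρ (of b))) {E : ℕ} (hE : 2 * Fintype.card ι ≤ E)
    (hb : 8 * Fintype.card ι * E ≤ norm (ρ (of b))) (x : FreeGroup α) :
    ∃ v : FreeGroup ι, norm v ≤ 16 ∧ (E : ℤ) < drift (fun i => ρ (of i)) ((ρ v)⁻¹ * x) := by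
  by_contra! hcon
  have hN : 2 ≤ Fintype.card ι := by
    have := Fintype.one_lt_card_iff.2 ⟨c, b, hbc⟩
    omega
  have hb' : 16 * E ≤ norm (ρ (of b)) := le_trans (by gcongr; omega) hb
  set D := norm (ρ (of b)) with hD
  have hpow : ∀ w : FreeGroup ι, norm w ≤ 1 → ∃ s : FreeGroup ι, (s = of b ∨ s = (of b)⁻¹) ∧
      norm ((ρ s ^ (15 + 1))⁻¹ * ((ρ w)⁻¹ * x)) + 14 * D ≤ norm ((ρ w)⁻¹ * x) := by
    intro w hw
    have dich := fun v hv => hg.dichotomy hE b hb (hcon v hv)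
    have key : ∀ s : FreeGroup ι, (s = of b ∨ s = (of b)⁻¹) → D ≤ lcp ((ρ w)⁻¹ * x) (ρ s) + E →
        norm ((ρ s ^ (15 + 1))⁻¹ * ((ρ w)⁻¹ * x)) + 14 * D ≤ norm ((ρ w)⁻¹ * x) := by
      intro s hs h0
      have hsD : norm (ρ s) = D := by
        rcases hs with rfl | rfl
        · rfl
        · rw [_root_.map_inv, norm_inv_eq]
      have := norm_inv_pow_mul_add_le (β := ρ s) (y := (ρ w)⁻¹ * x) (k := 15) (E := E)
        (by omega) (by omega) (by
          intro j hj
          have hn : norm (w * s ^ j) ≤ 16 := by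
            refine (norm_mul_le _ _).trans ?_
            have : norm (s ^ j) ≤ j := by
              rcases hs with rfl | rfl
              · exact (norm_of_pow b j).le
              · exact norm_of_pow_inv_le b j
            omega
          have hd := dich (w * s ^ j) hn
          have e : (ρ (w * s ^ j))⁻¹ * x = (ρ s ^ j)⁻¹ * ((ρ w)⁻¹ * x) := by
            rw [_root_.map_mul, _root_.map_pow, mul_inv_rev, mul_assoc]
          rw [e] at hd
          rcases hs with rfl | rfl
          · exact hd
          · simp only [_root_.map_inv, inv_inv, norm_inv_eq] at hd ⊢
            exact hd.symm)
      omega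
    rcases dich w (by omega) with h | h
    · exact ⟨of b, Or.inl rfl, key _ (Or.inl rfl) h.1⟩
    · exact ⟨(of b)⁻¹, Or.inr rfl, key _ (Or.inr rfl) (by simpa using h.1)⟩
  obtain ⟨s, hs, h1⟩ := hpow 1 (by simp)
  obtain ⟨s', hs', h2⟩ := hpow (of c) (by simp)
  have hnorm : ∀ s : FreeGroup ι, (s = of b ∨ s = (of b)⁻¹) → norm (ρ s) = D := by
    rintro s (rfl | rfl)
    · rfl
    · rw [_root_.map_inv, norm_inv_eq]
  refine not_commute_of hbc hs hs' (hρ ?_)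
  rw [_root_.map_mul ρ s, _root_.map_mul ρ _ s]
  refine commute_of_translations (x := x) (k := 15) (D := D) ?_ ?_ ?_ ?_
  · rw [hnorm s hs]
    omega
  · rw [_root_.map_mul, _root_.map_mul, _root_.map_inv]
    have a1 := norm_mul_le (ρ (of c) * ρ s') (ρ (of c))⁻¹
    have a2 := norm_mul_le (ρ (of c)) (ρ s')
    rw [norm_inv_eq] at a1
    rw [hnorm s' hs'] at a2
    omega
  · simp only [_root_.map_one, inv_one, one_mul] at h1
    omega
  · have e : (ρ (of c * s' * (of c)⁻¹) ^ (15 + 1))⁻¹ * x =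
        ρ (of c) * ((ρ s' ^ (15 + 1))⁻¹ * ((ρ (of c))⁻¹ * x)) := by
      rw [_root_.map_mul, _root_.map_mul, _root_.map_inv, conj_pow]
      group
    rw [e]
    have a1 := norm_mul_le (ρ (of c)) ((ρ s' ^ (15 + 1))⁻¹ * ((ρ (of c))⁻¹ * x))
    have a2 := norm_mul_le (ρ (of c))⁻¹ x
    rw [norm_inv_eq] at a2
    omega

end FreeGroup

namespace FreeGroup

theorem inv_mk_singleton {α : Type*} (a : α × Bool) : (mk [a])⁻¹ = mk [(a.1, !a.2)] := by
  simp [inv_mk, invRev]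

variable {α : Type*} [DecidableEq α]

theorem norm_mk_singleton (a : α × Bool) : norm (mk [a]) = 1 :=
  norm_mk_of_isReduced IsReduced.singleton

theorem lcp_mk_singleton (x : FreeGroup α) (a : α × Bool) :
    lcp x (mk [a]) = if x.toWord.head? = some a then 1 else 0 := by
  rw [lcp, toWord_mk, IsReduced.singleton.reduce_eq]
  rcases x.toWord with _ | ⟨b, l⟩
  · simp [List.lcpLength]
  · cases l <;> simp [List.lcpLength]

theorem norm_mul_mk_singleton (w : FreeGroup α) (a : α × Bool) :
    norm (w * mk [a]) + 2 * (if w⁻¹.toWord.head? = some a then 1 else 0) = norm w + 1 := by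
  have := norm_inv_mul_add w⁻¹ (mk [a])
  rwa [inv_inv, norm_inv_eq, norm_mk_singleton, lcp_mk_singleton] at this

theorem norm_mul_mk_singleton_eq_succ_iff (w : FreeGroup α) (a : α × Bool) :
    norm (w * mk [a]) = norm w + 1 ↔ w⁻¹.toWord.head? ≠ some a := by
  have := norm_mul_mk_singleton w a
  split_ifs at this with h
  · simp only [h, ne_eq, not_true, iff_false]
    omega
  · simp only [ne_eq, h, not_false_eq_true, iff_true]
    omega

theorem norm_mul_mk_singleton_succ_eq_iff (w : FreeGroup α) (a : α × Bool) :
    norm (w * mk [a]) + 1 = norm w ↔ w⁻¹.toWord.head? = some a := by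
  have := norm_mul_mk_singleton w a
  split_ifs at this with h
  · simp only [h, iff_true]
    omega
  · simp only [h, iff_false]
    omega

theorem exists_head_inv {w : FreeGroup α} (hw : w ≠ 1) : ∃ b, w⁻¹.toWord.head? = some b := by
  rcases h : w⁻¹.toWord with _ | ⟨b, l⟩
  · rw [toWord_eq_nil_iff, inv_eq_one] at h
    exact absurd h hw
  · exact ⟨b, rfl⟩

variable [Fintype α]

theorem finite_setOf_norm_le (n : ℕ) : {w : FreeGroup α | norm w ≤ n}.Finite :=
  Set.Finite.of_finite_image
    ((List.finite_length_le (α × Bool) n).subset (by rintro _ ⟨w, hw, rfl⟩; exact hw))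
    toWord_injective.injOn

/-- The ball of radius `n` in the Cayley tree. -/
noncomputable def ball (α : Type*) [DecidableEq α] [Fintype α] (n : ℕ) : Finset (FreeGroup α) :=
  (finite_setOf_norm_le n).toFinset

/-- The sphere of radius `n` in the Cayley tree. -/
noncomputable def sphere (α : Type*) [DecidableEq α] [Fintype α] (n : ℕ) :
    Finset (FreeGroup α) :=
  {w ∈ ball α n | norm w = n}

@[simp]
theorem mem_ball {n : ℕ} {w : FreeGroup α} : w ∈ ball α n ↔ norm w ≤ n := by simp [ball]

@[simp]
theorem mem_sphere {n : ℕ} {w : FreeGroup α} : w ∈ sphere α n ↔ norm w = n := by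
  simp only [sphere, Finset.mem_filter, mem_ball, and_iff_right_iff_imp]
  exact fun h => h.le

theorem sphere_zero : sphere α 0 = {1} := by
  ext w
  simp

theorem sum_ball_zero {M : Type*} [AddCommMonoid M] (f : FreeGroup α → M) :
    ∑ w ∈ ball α 0, f w = f 1 := by
  have : ball α 0 = {1} := by
    ext w
    simp
  rw [this, Finset.sum_singleton]

theorem sum_ball_succ {M : Type*} [AddCommMonoid M] (f : FreeGroup α → M) (n : ℕ) :
    ∑ w ∈ ball α (n + 1), f w = ∑ w ∈ ball α n, f w + ∑ w ∈ sphere α (n + 1), f w := by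
  rw [← Finset.sum_union]
  · congr 1
    ext w
    simp only [mem_ball, Finset.mem_union, mem_sphere]
    omega
  · rw [Finset.disjoint_left]
    intro w
    simp only [mem_ball, mem_sphere]
    omega

/-- Reversing the edges between two consecutive spheres. -/
theorem sum_sphere_edges {M : Type*} [AddCommMonoid M]
    (F : FreeGroup α → FreeGroup α → M) (n : ℕ) :
    (∑ w ∈ sphere α n, ∑ a : α × Bool,
      if w⁻¹.toWord.head? = some a then 0 else F w (w * mk [a])) =
    ∑ u ∈ sphere α (n + 1), ∑ a : α × Bool,
      if u⁻¹.toWord.head? = some a then F (u * mk [a]) u else 0 := by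
  have h : ∀ (w : FreeGroup α) (a : α × Bool) (x : M),
      (if w⁻¹.toWord.head? = some a then 0 else x) =
        if norm (w * mk [a]) = norm w + 1 then x else 0 := by
    intro w a x
    simp only [norm_mul_mk_singleton_eq_succ_iff, ite_not]
  have h' : ∀ (w : FreeGroup α) (a : α × Bool) (x : M),
      (if w⁻¹.toWord.head? = some a then x else 0) =
        if norm (w * mk [a]) + 1 = norm w then x else 0 := by
    intro w a x
    simp only [norm_mul_mk_singleton_succ_eq_iff]
  simp only [h, h']
  rw [← Finset.sum_product', ← Finset.sum_product', ← Finset.sum_filter, ← Finset.sum_filter]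
  have e : ∀ (w : FreeGroup α) (a : α × Bool), w * mk [a] * mk [(a.1, !a.2)] = w := by
    intro w a
    rw [← inv_mk_singleton, mul_inv_cancel_right]
  refine Finset.sum_bij' (fun p _ => (p.1 * mk [p.2], (p.2.1, !p.2.2)))
    (fun p _ => (p.1 * mk [p.2], (p.2.1, !p.2.2))) ?_ ?_ ?_ ?_ ?_
  · rintro ⟨w, a⟩
    simp only [Finset.mem_filter, Finset.mem_product, mem_sphere, Finset.mem_univ, e, and_true]
    omega
  · rintro ⟨w, a⟩
    simp only [Finset.mem_filter, Finset.mem_product, mem_sphere, Finset.mem_univ, e, and_true]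
    omega
  · rintro ⟨w, a⟩ _
    simp [e]
  · rintro ⟨w, a⟩ _
    simp [e]
  · rintro ⟨w, a⟩ _
    simp [e]

/-- The number of ways to extend an element of a sphere to the next sphere. -/
theorem sum_sphere_succ (f : FreeGroup α → ℝ) (n : ℕ) :
    ∑ u ∈ sphere α (n + 1), f u = ∑ w ∈ sphere α n, ∑ a : α × Bool,
      if w⁻¹.toWord.head? = some a then 0 else f (w * mk [a]) := by
  rw [sum_sphere_edges (fun _ u => f u)]
  refine Finset.sum_congr rfl fun u hu => ?_
  obtain ⟨b, hb⟩ := exists_head_inv (w := u) (by rintro rfl; simp at hu)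
  simp only [hb, Option.some_inj, Finset.sum_ite_eq, Finset.mem_univ, if_true]

theorem sum_ite_head_inv {w : FreeGroup α} (hw : w ≠ 1) (x : ℝ) :
    (∑ a : α × Bool, if w⁻¹.toWord.head? = some a then 0 else x) =
      (2 * Fintype.card α - 1) * x := by
  obtain ⟨b, hb⟩ := exists_head_inv hw
  have : ∀ a, (if w⁻¹.toWord.head? = some a then 0 else x) = x - if b = a then x else 0 := by
    intro a
    simp only [hb, Option.some_inj]
    split_ifs <;> simp
  simp only [this, Finset.sum_sub_distrib, Finset.sum_const, Finset.sum_ite_eq, Finset.mem_univ,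
    if_true, Finset.card_univ, Fintype.card_prod, Fintype.card_bool, nsmul_eq_mul]
  push_cast
  ring

theorem sum_sphere_mul (f : FreeGroup α → ℝ) (n : ℕ) :
    ∑ w ∈ sphere α (n + 1), ∑ a : α × Bool, f (w * mk [a]) =
      ∑ u ∈ sphere α (n + 2), f u + ∑ w ∈ sphere α n, ∑ a : α × Bool,
        if w⁻¹.toWord.head? = some a then 0 else f w := by
  rw [sum_sphere_succ f, sum_sphere_edges (fun w _ => f w), ← Finset.sum_add_distrib]
  refine Finset.sum_congr rfl fun w _ => ?_
  rw [← Finset.sum_add_distrib]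
  refine Finset.sum_congr rfl fun a _ => ?_
  split_ifs <;> simp

theorem sum_letters_const {α : Type*} [Fintype α] (x : ℝ) :
    ∑ _a : α × Bool, x = 2 * Fintype.card α * x := by
  rw [Finset.sum_const, Finset.card_univ, Fintype.card_prod, Fintype.card_bool, nsmul_eq_mul]
  push_cast
  ring

/-- Discrete divergence theorem on balls of the Cayley tree. -/
theorem sum_ball_laplacian (f : FreeGroup α → ℝ) (n : ℕ) :
    ∑ w ∈ ball α (n + 1), ∑ a : α × Bool, (f (w * mk [a]) - f w) =
      ∑ u ∈ sphere α (n + 2), f u - (2 * Fintype.card α - 1) * ∑ w ∈ sphere α (n + 1), f w := by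
  induction n with
  | zero =>
    rw [sum_ball_succ, sum_ball_zero]
    simp only [Finset.sum_sub_distrib, zero_add, sum_sphere_mul, sum_letters_const, sphere_zero,
      Finset.sum_singleton, ← Finset.mul_sum]
    rw [show sphere α 1 = sphere α (0 + 1) from rfl, sum_sphere_succ f 0]
    simp [sphere_zero]
    ring
  | succ n ih =>
    rw [sum_ball_succ, ih]
    simp only [Finset.sum_sub_distrib, sum_sphere_mul, sum_letters_const, ← Finset.mul_sum]
    have : ∑ w ∈ sphere α (n + 1), (∑ a : α × Bool,
        if w⁻¹.toWord.head? = some a then 0 else f w) =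
        (2 * Fintype.card α - 1) * ∑ w ∈ sphere α (n + 1), f w := by
      rw [Finset.mul_sum]
      refine Finset.sum_congr rfl fun w hw => sum_ite_head_inv ?_ _
      rintro rfl
      simp at hw
    rw [this]
    ring

theorem card_sphere_one : ((sphere α 1).card : ℝ) = 2 * Fintype.card α := by
  have := sum_sphere_succ (α := α) (fun _ => 1) 0
  simp only [zero_add, sphere_zero, Finset.sum_singleton, Finset.sum_const, nsmul_eq_mul,
    mul_one] at this
  rw [this]
  simp
  ring

theorem card_sphere_succ_succ (n : ℕ) : ((sphere α (n + 2)).card : ℝ) =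
    (2 * Fintype.card α - 1) * (sphere α (n + 1)).card := by
  have h := sum_sphere_succ (α := α) (fun _ => 1) (n + 1)
  rw [Finset.sum_congr rfl fun w hw => sum_ite_head_inv (w := w)
    (by rintro rfl; simp at hw) (1 : ℝ)] at h
  simp only [Finset.sum_const, nsmul_eq_mul, mul_one] at h
  rw [h, mul_comm]

theorem card_sphere_succ (n : ℕ) : ((sphere α (n + 1)).card : ℝ) =
    2 * Fintype.card α * (2 * Fintype.card α - 1) ^ n := by
  induction n with
  | zero => simp [card_sphere_one]
  | succ n ih =>
    rw [card_sphere_succ_succ, ih]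
    ring

theorem card_ball_le (hα : 2 ≤ Fintype.card α) (n : ℕ) :
    ((ball α n).card : ℝ) ≤ (sphere α (n + 1)).card := by
  have hα' : (2 : ℝ) ≤ Fintype.card α := by exact_mod_cast hα
  induction n with
  | zero =>
    have := sum_ball_zero (α := α) (fun _ => (1 : ℝ))
    simp only [Finset.sum_const, nsmul_eq_mul, mul_one] at this
    rw [this, zero_add, card_sphere_one]
    linarith
  | succ n ih =>
    have := sum_ball_succ (α := α) (fun _ => (1 : ℝ)) n
    simp only [Finset.sum_const, nsmul_eq_mul, mul_one] at this
    rw [this, card_sphere_succ_succ]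
    nlinarith [Nat.cast_nonneg (α := ℝ) (sphere α (n + 1)).card]

end FreeGroup

namespace FreeGroup

variable {α ι : Type*} [DecidableEq α] [Fintype ι]

theorem sum_norm_mul_sub_eq_drift (ρ : FreeGroup ι →* FreeGroup α) (w : FreeGroup ι) :
    ∑ a : ι × Bool, ((norm (ρ (w * mk [a])) : ℝ) - norm (ρ w)) =
      drift (fun i => ρ (of i)) (ρ w)⁻¹ := by
  have hf : ∀ i : ι, mk [(i, false)] = (of i)⁻¹ := fun i => rfl
  have ht : ∀ i : ι, mk [(i, true)] = of i := fun i => rfl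
  simp only [drift, Fintype.sum_prod_type, Fintype.sum_bool, hf, ht, inv_inv, norm_inv_eq,
    _root_.map_mul, _root_.map_inv]
  push_cast
  refine Finset.sum_congr rfl fun i _ => ?_
  ring

variable [DecidableEq ι]

/-- The average of `f` over the sphere of radius `n`. -/
noncomputable def sphereMean (f : FreeGroup ι → ℝ) (n : ℕ) : ℝ :=
  (∑ w ∈ sphere ι n, f w) / (sphere ι n).card

theorem card_sphere_succ_pos (h : 2 ≤ Fintype.card ι) (n : ℕ) :
    (0 : ℝ) < (sphere ι (n + 1)).card := by
  rw [card_sphere_succ]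
  have h' : (2 : ℝ) ≤ Fintype.card ι := by exact_mod_cast h
  have : (0 : ℝ) < 2 * Fintype.card ι - 1 := by linarith
  positivity

theorem card_sphere_add (n k : ℕ) : ((sphere ι (n + 1 + k)).card : ℝ) =
    (2 * Fintype.card ι - 1) ^ k * (sphere ι (n + 1)).card := by
  rw [show n + 1 + k = n + k + 1 by omega, card_sphere_succ, card_sphere_succ]
  ring

/-- If a nonnegative function exceeds `E` near every point, then its sum over a ball is large. -/
theorem card_sphere_mul_le_sum_ball {h : FreeGroup ι → ℝ} (h0 : ∀ w, 0 ≤ h w) {E : ℝ} {k : ℕ}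
    (hE : ∀ w, ∃ v, norm v ≤ k ∧ E ≤ h (w * v)) (n : ℕ) :
    (sphere ι n).card * E ≤ (ball ι k).card * ∑ u ∈ ball ι (n + k), h u := by
  calc ((sphere ι n).card : ℝ) * E = ∑ w ∈ sphere ι n, E := by simp
    _ ≤ ∑ w ∈ sphere ι n, ∑ v ∈ ball ι k, h (w * v) := by
        refine Finset.sum_le_sum fun w _ => ?_
        obtain ⟨v, hv, hEv⟩ := hE w
        exact hEv.trans (Finset.single_le_sum (f := fun v => h (w * v)) (fun _ _ => h0 _)
          (mem_ball.2 hv))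
    _ = ∑ v ∈ ball ι k, ∑ w ∈ sphere ι n, h (w * v) := Finset.sum_comm
    _ ≤ ∑ v ∈ ball ι k, ∑ u ∈ ball ι (n + k), h u := by
        refine Finset.sum_le_sum fun v hv => ?_
        rw [← Finset.sum_image (g := fun w => w * v) (f := h) (mul_left_injective v).injOn]
        refine Finset.sum_le_sum_of_subset_of_nonneg ?_ fun _ _ _ => h0 _
        rw [Finset.image_subset_iff]
        intro w hw
        rw [mem_sphere] at hw
        rw [mem_ball] at hv ⊢
        have := norm_mul_le w v
        omega
    _ = _ := by simp

/-- The linear growth rate of the mean length of `ρ w` over spheres. -/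
theorem IsEnergyMinimal.le_sphereMean {ρ : FreeGroup ι →* FreeGroup α}
    (hρ : Function.Injective ρ) (hg : IsEnergyMinimal fun i => ρ (of i)) {b c : ι} (hbc : c ≠ b)
    (hc : norm (ρ (of c)) ≤ norm (ρ (of b))) {E : ℕ} (hE : 2 * Fintype.card ι ≤ E)
    (hb : 8 * Fintype.card ι * E ≤ norm (ρ (of b))) (n : ℕ) :
    n * (E / ((2 * Fintype.card ι - 1) ^ 17 * (ball ι 16).card) - 2 * Fintype.card ι) ≤
      sphereMean (fun w => (norm (ρ w) : ℝ)) (n + 17) := by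
  have hN : 2 ≤ Fintype.card ι := by
    have := Fintype.one_lt_card_iff.2 ⟨c, b, hbc⟩
    omega
  have hN' : (2 : ℝ) ≤ Fintype.card ι := by exact_mod_cast hN
  have hq : (0 : ℝ) < 2 * Fintype.card ι - 1 := by linarith
  induction n with
  | zero =>
    simp only [Nat.cast_zero, zero_mul, sphereMean]
    positivity
  | succ n ih =>
    have hV : (0 : ℝ) < (ball ι 16).card := by
      exact_mod_cast Finset.card_pos.2 ⟨1, by simp⟩
    have hS := card_sphere_succ_pos hN n
    have hS17 := card_sphere_succ_pos hN (n + 16)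
    have hS18 := card_sphere_succ_pos hN (n + 17)
    have hlap := sum_ball_laplacian (fun w => (norm (ρ w) : ℝ)) (n + 16)
    simp only [sum_norm_mul_sub_eq_drift] at hlap
    have hlow := card_sphere_mul_le_sum_ball (ι := ι) (E := E) (k := 16)
      (h := fun w => (drift (fun i => ρ (of i)) (ρ w)⁻¹ : ℝ) + 2 * Fintype.card ι)
      (fun w => by
        have := hg.neg_le_drift (ρ w)⁻¹
        have : (-(2 * Fintype.card ι : ℤ) : ℝ) ≤ (drift (fun i => ρ (of i)) (ρ w)⁻¹ : ℤ) := by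
          exact_mod_cast this
        push_cast at this
        linarith)
      (fun w => by
        obtain ⟨v, hv, hvE⟩ := hg.exists_lt_drift hρ hbc hc hE hb (ρ w)⁻¹
        refine ⟨v, hv, ?_⟩
        rw [_root_.map_mul, mul_inv_rev]
        have : (E : ℝ) < (drift (fun i => ρ (of i)) ((ρ v)⁻¹ * (ρ w)⁻¹) : ℤ) := by
          exact_mod_cast hvE
        linarith) (n + 1)
    rw [Finset.sum_add_distrib, show n + 1 + 16 = n + 16 + 1 by omega, hlap, Finset.sum_const,
      nsmul_eq_mul] at hlow
    have hball := card_ball_le hN (n + 17)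
    have e17 := card_sphere_add (ι := ι) n 17
    have e18 := card_sphere_succ_succ (α := ι) (n + 16)
    simp only [sphereMean] at ih ⊢
    rw [show n + 1 + 17 = n + 18 by omega] at *
    rw [show n + 16 + 1 = n + 17 by omega, show n + 16 + 2 = n + 18 by omega,
      show n + 17 + 1 = n + 18 by omega] at *
    set A := ∑ w ∈ sphere ι (n + 17), (norm (ρ w) : ℝ)
    set A' := ∑ w ∈ sphere ι (n + 18), (norm (ρ w) : ℝ)
    set q : ℝ := 2 * Fintype.card ι - 1
    set V : ℝ := ((ball ι 16).card : ℝ)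
    set s : ℝ := ((sphere ι (n + 1)).card : ℝ)
    set s' : ℝ := ((sphere ι (n + 17)).card : ℝ)
    set t : ℝ := ((sphere ι (n + 18)).card : ℝ)
    set B : ℝ := ((ball ι (n + 17)).card : ℝ)
    have hmean : A / s' = q * A / t := by
      rw [e18]
      field_simp
    have hEt : E / (q ^ 17 * V) = s * E / V / t := by
      rw [e17]
      field_simp
    have h1 : s * E / V ≤ A' - q * A + B * (2 * Fintype.card ι) := by
      rw [div_le_iff₀ hV]
      linarith
    have h2 : s * E / V ≤ A' - q * A + t * (2 * Fintype.card ι) := by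
      have := mul_le_mul_of_nonneg_right hball (show (0 : ℝ) ≤ 2 * Fintype.card ι by positivity)
      linarith
    have h3 := div_le_div_of_nonneg_right h2 hS18.le
    have h4 : (A' - q * A + t * (2 * Fintype.card ι)) / t =
        A' / t - q * A / t + 2 * Fintype.card ι := by
      field_simp
    rw [hmean, hEt] at ih
    rw [hEt]
    push_cast
    linarith

theorem norm_map_le_mul {α ι : Type*} [DecidableEq α] [DecidableEq ι]
    {f : FreeGroup ι →* FreeGroup α} {K : ℕ}
    (hK : ∀ i, norm (f (of i)) ≤ K) (w : FreeGroup ι) : norm (f w) ≤ K * norm w := by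
  have key : ∀ l : List (ι × Bool), norm (f (mk l)) ≤ K * l.length := by
    intro l
    induction l with
    | nil => simp [← one_eq_mk]
    | cons a l ih =>
      have h1 : norm (f (mk [a])) ≤ K := by
        rcases a with ⟨i, _ | _⟩
        · rw [show mk [(i, false)] = (of i)⁻¹ from rfl, _root_.map_inv, norm_inv_eq]
          exact hK i
        · exact hK i
      rw [← List.singleton_append, ← mul_mk, _root_.map_mul]
      refine (norm_mul_le _ _).trans ?_
      simp only [List.singleton_append, List.length_cons, mul_add, mul_one]
      omega
  rw [← mk_toWord (x := w), norm_mk_of_isReduced isReduced_toWord]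
  exact key _

theorem exists_norm_symm_le (M : ℕ) : ∃ K : ℕ, 1 ≤ K ∧ ∀ ρ : MulAut (FreeGroup ι),
    (∀ i, norm (ρ (of i)) ≤ M) → ∀ i, norm (ρ.symm (of i)) ≤ K := by
  have hfin : {ρ : MulAut (FreeGroup ι) | ∀ i, norm (ρ (of i)) ≤ M}.Finite := by
    refine Set.Finite.of_finite_image (f := fun ρ i => ρ (of i)) ?_ ?_
    · refine (Set.Finite.pi' fun _ : ι => finite_setOf_norm_le (α := ι) M).subset ?_
      rintro _ ⟨ρ, hρ, rfl⟩ i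
      exact hρ i
    · intro ρ _ σ _ h
      have : (ρ : FreeGroup ι →* FreeGroup ι) = σ := ext_hom _ _ fun i => congrFun h i
      exact MulEquiv.ext fun w => DFunLike.congr_fun this w
  refine ⟨1 + ∑ ρ ∈ hfin.toFinset, ∑ i, norm (ρ.symm (of i)), by omega, fun ρ hρ i => ?_⟩
  have h1 := Finset.single_le_sum (f := fun i => norm (ρ.symm (of i))) (fun _ _ => Nat.zero_le _)
    (Finset.mem_univ i)
  have h2 := Finset.single_le_sum (f := fun ρ : MulAut (FreeGroup ι) => ∑ i, norm (ρ.symm (of i)))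
    (fun _ _ => Nat.zero_le _) (hfin.mem_toFinset.2 hρ)
  omega

/-- The mean length of `ρ w` over spheres grows at a rate comparable to the size of `ρ`, uniformly
over all automorphisms `ρ` that cannot be shortened by a conjugation. -/
theorem exists_mul_le_sphereMean (hN : 2 ≤ Fintype.card ι) : ∃ c : ℝ, 0 < c ∧
    ∀ ρ : MulAut (FreeGroup ι), (IsEnergyMinimal fun i => ρ (of i)) → ∀ b : ι,
      (∀ i, norm (ρ (of i)) ≤ norm (ρ (of b))) → ∀ n : ℕ,
        c * norm (ρ (of b)) * n ≤ sphereMean (fun w => (norm (ρ w) : ℝ)) (n + 17) := by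
  have hN' : (2 : ℝ) ≤ Fintype.card ι := by exact_mod_cast hN
  set V : ℝ := (2 * Fintype.card ι - 1) ^ 17 * (ball ι 16).card with hV
  have hV1 : 1 ≤ V := by
    have h1 : (1 : ℝ) ≤ (2 * Fintype.card ι - 1) ^ 17 := one_le_pow₀ (by linarith)
    have h2 : (1 : ℝ) ≤ (ball ι 16).card := by
      exact_mod_cast Finset.card_pos.2 ⟨1, by simp⟩
    exact one_le_mul_of_one_le_of_one_le h1 h2
  set T : ℕ := ⌈4 * Fintype.card ι * V⌉₊ with hT
  have hTV : 4 * Fintype.card ι * V ≤ T := Nat.le_ceil _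
  set M : ℕ := 16 * Fintype.card ι * (T + 1) with hM
  obtain ⟨K, hK1, hK⟩ := exists_norm_symm_le (ι := ι) M
  have hM0 : (0 : ℝ) < M := by
    have : 0 < M := by positivity
    exact_mod_cast this
  have hK0 : (0 : ℝ) < K := by exact_mod_cast hK1
  refine ⟨min (1 / (32 * Fintype.card ι * V)) (1 / (K * M)), by positivity, ?_⟩
  intro ρ hρ b hb n
  set D := norm (ρ (of b)) with hD
  rcases le_or_gt M D with hMD | hMD
  · obtain ⟨c, hc⟩ := Fintype.exists_ne_of_one_lt_card (by omega) b
    have hNpos : 0 < 8 * Fintype.card ι := by omega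
    have hE1 : 8 * Fintype.card ι * (D / (8 * Fintype.card ι)) ≤ D := Nat.mul_div_le _ _
    have hE2 : D < 8 * Fintype.card ι * (D / (8 * Fintype.card ι) + 1) := by
      have := Nat.lt_mul_div_succ D hNpos
      exact this
    have hE3 : T + 1 ≤ D / (8 * Fintype.card ι) := by
      rw [Nat.le_div_iff_mul_le hNpos]
      refine le_trans ?_ hMD
      rw [hM]
      nlinarith
    set E := D / (8 * Fintype.card ι)
    have hET : (T : ℝ) ≤ E := by exact_mod_cast (show T ≤ E by omega)
    have hE4 : (4 * Fintype.card ι : ℝ) ≤ E := by nlinarith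
    have hE5 : 2 * Fintype.card ι ≤ E := by
      have : 4 * Fintype.card ι ≤ E := by exact_mod_cast hE4
      omega
    have := hρ.le_sphereMean (ρ := ρ.toMonoidHom) ρ.injective hc (hb c) hE5 hE1 n
    refine le_trans ?_ this
    rw [mul_comm]
    refine mul_le_mul_of_nonneg_left ?_ (Nat.cast_nonneg n)
    rw [← hV]
    have hDE : (D : ℝ) ≤ 16 * Fintype.card ι * E := by
      have h1 : (D : ℝ) ≤ 8 * Fintype.card ι * (E + 1) := by exact_mod_cast hE2.le
      have h2 : (1 : ℝ) ≤ E := by linarith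
      nlinarith
    calc min (1 / (32 * Fintype.card ι * V)) (1 / (K * M)) * (D : ℝ)
        ≤ 1 / (32 * Fintype.card ι * V) * (16 * Fintype.card ι * E) :=
          mul_le_mul (min_le_left _ _) hDE (Nat.cast_nonneg _) (by positivity)
      _ = E / (2 * V) := by field_simp; ring
      _ ≤ E / V - 2 * Fintype.card ι := by
          have : 2 * Fintype.card ι ≤ E / (2 * V) := by
            rw [le_div_iff₀ (by positivity)]
            linarith
          have e : E / V = E / (2 * V) + E / (2 * V) := by field_simp; norm_num
          linarith
  · have hS := card_sphere_succ_pos hN (n + 16)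
    have hw : ∀ w ∈ sphere ι (n + 16 + 1), (n : ℝ) / K ≤ norm (ρ w) := by
      intro w hw
      rw [mem_sphere] at hw
      have h1 := norm_map_le_mul (f := ρ.symm.toMonoidHom)
        (hK ρ fun i => (hb i).trans hMD.le) (ρ w)
      have h2 : ρ.symm.toMonoidHom (ρ w) = w := ρ.symm_apply_apply w
      rw [h2, hw] at h1
      rw [div_le_iff₀ hK0]
      have : n ≤ norm (ρ w) * K := by
        rw [mul_comm]
        omega
      exact_mod_cast this
    have hmean : (n : ℝ) / K ≤ sphereMean (fun w => (norm (ρ w) : ℝ)) (n + 17) := by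
      rw [sphereMean, le_div_iff₀ hS, mul_comm, ← nsmul_eq_mul]
      exact Finset.card_nsmul_le_sum _ _ _ hw
    refine le_trans ?_ hmean
    calc min (1 / (32 * Fintype.card ι * V)) (1 / (K * M)) * (D : ℝ) * n
        ≤ 1 / (K * M) * M * n := by
          refine mul_le_mul_of_nonneg_right ?_ (Nat.cast_nonneg _)
          refine mul_le_mul (min_le_right _ _) ?_ (Nat.cast_nonneg _) (by positivity)
          exact_mod_cast hMD.le
      _ = n / K := by field_simp

end FreeGroup

namespace FreeGroup

variable {α ι : Type*} [DecidableEq α]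

/-! ### Bounded cancellation -/

theorem lcp_mk_take (x : FreeGroup α) (n : ℕ) :
    lcp (mk (x.toWord.take n)) x = norm (mk (x.toWord.take n)) := by
  have h : IsReduced (x.toWord.take n) := List.IsChain.take isReduced_toWord n
  rw [lcp, norm, toWord_mk, h.reduce_eq]
  conv_lhs => rw [← List.take_append_drop n x.toWord]
  simpa using List.lcpLength_self_append (x.toWord.take n) (x.toWord.drop n)

/-- A path with jumps of length at most `K` passes within `K` of every point separating its
endpoints. -/
theorem exists_norm_inv_mul_le {p : ℕ → FreeGroup α} {K : ℕ} (h0 : p 0 = 1)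
    (hp : ∀ k, norm ((p k)⁻¹ * p (k + 1)) ≤ K) {z : FreeGroup α} {n : ℕ}
    (hz : lcp z (p n) = norm z) : ∃ j, norm (z⁻¹ * p j) ≤ K := by
  by_contra! hcon
  have key : ∀ k, lcp z (p k) < norm z := by
    intro k
    have hk := hcon k
    have a1 := norm_inv_mul_add z (p k)
    induction k with
    | zero =>
      rw [h0, lcp_comm, lcp_one_left] at a1 ⊢
      rw [Nat.pos_iff_ne_zero]
      intro hz0
      rw [norm_eq_zero] at hz0
      rw [h0, hz0] at hk
      simp at hk
    | succ k ih =>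
      have a0 := ih (hcon k) (norm_inv_mul_add z (p k))
      have a2 := norm_inv_mul_add (p k) (p (k + 1))
      have a3 := min_lcp_le z (p (k + 1)) (p k)
      rw [lcp_comm (p (k + 1))] at a3
      have a4 := hp k
      have a5 := lcp_le_norm_right z (p k)
      have a6 := lcp_le_norm_left z (p (k + 1))
      omega
  exact (key n).ne hz

variable [DecidableEq ι]

theorem norm_map_mk_take_le {ρ : FreeGroup ι →* FreeGroup α} {K : ℕ}
    (hK : ∀ i, norm (ρ (of i)) ≤ K) (l : List (ι × Bool)) (k : ℕ) :
    norm ((ρ (mk (l.take k)))⁻¹ * ρ (mk (l.take (k + 1)))) ≤ K := by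
  rw [List.take_add_one, ← mul_mk, _root_.map_mul, inv_mul_cancel_left]
  refine (norm_map_le_mul hK _).trans ?_
  have h1 : norm (mk (l[k]?).toList) ≤ (l[k]?).toList.length := norm_mk_le
  have h2 : (l[k]?).toList.length ≤ 1 := by
    cases l[k]? <;> simp
  calc K * norm (mk (l[k]?).toList) ≤ K * 1 := Nat.mul_le_mul_left _ (h1.trans h2)
    _ = K := mul_one K

/-- Bounded cancellation: automorphisms distort Gromov products by a bounded amount. -/
theorem lcp_map_le_of_lcp_eq_zero {ρ : FreeGroup ι →* FreeGroup α} {K K' : ℕ}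
    (hK : ∀ i, norm (ρ (of i)) ≤ K) (hK' : ∀ w, norm w ≤ K' * norm (ρ w)) {x y : FreeGroup ι}
    (hxy : lcp x y = 0) : lcp (ρ x) (ρ y) ≤ K * (K' * (2 * K)) + K := by
  set z := mk ((ρ x).toWord.take (lcp (ρ x) (ρ y))) with hz
  have hzx : lcp z (ρ x) = norm z := lcp_mk_take _ _
  have hzy : lcp z (ρ y) = norm z := by
    rw [hz, List.take_eq_take_of_le_lcpLength (le_refl (lcp (ρ x) (ρ y)))]
    exact lcp_mk_take _ _
  have hnz : norm z = lcp (ρ x) (ρ y) := by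
    rw [hz, norm_mk_of_isReduced (List.IsChain.take isReduced_toWord _),
      List.length_take]
    exact min_eq_left (lcp_le_norm_left _ _)
  have hex : ∀ v : FreeGroup ι, lcp z (ρ v) = norm z →
      ∃ u, lcp u v = norm u ∧ norm (z⁻¹ * ρ u) ≤ K := by
    intro v hv
    obtain ⟨j, hj⟩ := exists_norm_inv_mul_le (p := fun k => ρ (mk (v.toWord.take k))) (z := z)
      (n := norm v) (by simp [← one_eq_mk]) (norm_map_mk_take_le hK _)
      (by rw [norm, List.take_length, mk_toWord]; exact hv)
    exact ⟨_, lcp_mk_take v j, hj⟩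
  obtain ⟨u, hu, hu'⟩ := hex x hzx
  obtain ⟨v, hv, hv'⟩ := hex y hzy
  have huv : lcp u v = 0 := by
    have a1 := min_lcp_le x u v
    have a2 := min_lcp_le x v y
    rw [lcp_comm x u] at a1
    have a3 := lcp_le_norm_left u v
    have a4 := lcp_le_norm_right u v
    omega
  have h1 := norm_inv_mul_add u v
  have h2 := hK' (u⁻¹ * v)
  have h3 : norm (ρ (u⁻¹ * v)) ≤ 2 * K := by
    have e : ρ (u⁻¹ * v) = (z⁻¹ * ρ u)⁻¹ * (z⁻¹ * ρ v) := by
      rw [_root_.map_mul, _root_.map_inv]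
      group
    have := norm_mul_le (z⁻¹ * ρ u)⁻¹ (z⁻¹ * ρ v)
    rw [norm_inv_eq] at this
    rw [e]
    omega
  have h4 := norm_map_le_mul hK u
  have h5 : norm z ≤ norm (ρ u) + norm (z⁻¹ * ρ u) := by
    have := norm_mul_le (ρ u) (z⁻¹ * ρ u)⁻¹
    rw [norm_inv_eq] at this
    convert this using 2
    group
  have h6 : norm u ≤ K' * (2 * K) := by
    have := Nat.mul_le_mul_left K' h3
    omega
  have h7 := Nat.mul_le_mul_left K h6
  omega

/-- The cyclically reduced length is bounded below in terms of the length and the cancellation in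
`g * g`. -/
theorem norm_le_norm_conj_add (g h : FreeGroup α) :
    norm g ≤ norm (h * g * h⁻¹) + 2 * lcp g g⁻¹ := by
  obtain ⟨r, s, -, H⟩ := exists_toWord_pow g
  have hn : ∀ k, norm (g ^ (k + 1)) = 2 * r.length + (k + 1) * s.length := by
    intro k
    rw [norm, H k]
    simp only [List.length_append, List.length_flatten, List.map_replicate,
      List.sum_replicate, invRev_length, smul_eq_mul]
    omega
  have h0 := hn 0
  have h1 := hn 1
  have h2 := norm_inv_mul_add g g⁻¹
  have e : norm (g⁻¹ * g⁻¹) = norm (g ^ (1 + 1)) := by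
    rw [← mul_inv_rev, norm_inv_eq, pow_succ, pow_one]
  rw [norm_inv_eq, e] at h2
  rw [zero_add, pow_one] at h0
  have hpow : ∀ k, norm ((h * g * h⁻¹) ^ k) ≤ k * norm (h * g * h⁻¹) := by
    intro k
    induction k with
    | zero => simp
    | succ k ih =>
      rw [pow_succ, add_mul, one_mul]
      exact (norm_mul_le _ _).trans (by omega)
  have h3 := hpow (2 * norm h + 1)
  have h4 : norm (g ^ (2 * norm h + 1)) ≤
      norm h + norm ((h * g * h⁻¹) ^ (2 * norm h + 1)) + norm h := by
    have e : g ^ (2 * norm h + 1) = h⁻¹ * (h * g * h⁻¹) ^ (2 * norm h + 1) * h := by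
      rw [conj_pow]
      group
    rw [e]
    have a1 := norm_mul_le (h⁻¹ * (h * g * h⁻¹) ^ (2 * norm h + 1)) h
    have a2 := norm_mul_le h⁻¹ ((h * g * h⁻¹) ^ (2 * norm h + 1))
    rw [norm_inv_eq] at a2
    omega
  rw [hn] at h4
  have h5 : s.length ≤ norm (h * g * h⁻¹) := by
    by_contra! hlt
    have := Nat.mul_le_mul_left (2 * norm h + 1) (Nat.succ_le_of_lt hlt)
    rw [Nat.succ_eq_add_one, mul_add, mul_one] at this
    omega
  omega

variable [Fintype ι]

/-- Every nontrivial element extends by one letter to a cyclically reduced one. -/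
theorem exists_letter_cyclically_reduced (hN : 2 ≤ Fintype.card ι) {w : FreeGroup ι} (hw : w ≠ 1) :
    ∃ a : ι × Bool, w⁻¹.toWord.head? ≠ some a ∧ lcp (w * mk [a]) (w * mk [a])⁻¹ = 0 := by
  obtain ⟨b, hb⟩ := exists_head_inv hw
  obtain ⟨c, hc⟩ := exists_head_inv (inv_ne_one.2 hw)
  rw [inv_inv] at hc
  obtain ⟨a, -, ha⟩ := Finset.exists_mem_notMem_of_card_lt_card
    (s := {b, (c.1, !c.2)}) (t := (Finset.univ : Finset (ι × Bool))) (by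
      rw [Finset.card_univ, Fintype.card_prod, Fintype.card_bool]
      have := Finset.card_le_two (a := b) (b := (c.1, !c.2))
      omega)
  simp only [Finset.mem_insert, Finset.mem_singleton, not_or] at ha
  have hba : w⁻¹.toWord.head? ≠ some a := by
    rw [hb]
    simpa using Ne.symm ha.1
  refine ⟨a, hba, ?_⟩
  have h1 := (norm_mul_mk_singleton_eq_succ_iff w a).2 hba
  have h2 : lcp w (mk [a])⁻¹ = 0 := by
    rw [inv_mk_singleton, lcp_mk_singleton, hc, if_neg]
    rw [Option.some_inj]
    rintro rfl
    exact ha.2 (by simp)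
  have h3 := norm_inv_mul_add (mk [a])⁻¹ (w * mk [a])⁻¹
  have h4 := norm_inv_mul_add w (w * mk [a])
  have e3 : (mk [a])⁻¹⁻¹ * (w * mk [a])⁻¹ = w⁻¹ := by group
  rw [e3, norm_inv_eq, norm_inv_eq, norm_inv_eq, norm_mk_singleton] at h3
  rw [inv_mul_cancel_left, norm_mk_singleton] at h4
  have h5 := min_lcp_le w (w * mk [a]) (w * mk [a])⁻¹
  have h6 := min_lcp_le w (w * mk [a])⁻¹ (mk [a])⁻¹
  rw [lcp_comm _ (mk [a])⁻¹] at h6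
  have h7 : 0 < norm w := Nat.pos_of_ne_zero (mt norm_eq_zero.1 hw)
  omega

end FreeGroup

namespace FreeGroup

/-! ### Cyclically reduced length -/

variable {N : ℕ}

theorem cyclen_le_norm_conj (w h : FreeGroup (Fin N)) : cyclen w ≤ norm (h * w * h⁻¹) :=
  Nat.sInf_le ⟨h, rfl⟩

theorem exists_norm_conj_eq_cyclen (w : FreeGroup (Fin N)) :
    ∃ h, norm (h * w * h⁻¹) = cyclen w :=
  Nat.sInf_mem (Set.range_nonempty fun g : FreeGroup (Fin N) => wlen (g * w * g⁻¹))

theorem cyclen_le_norm (w : FreeGroup (Fin N)) : cyclen w ≤ norm w := by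
  simpa using cyclen_le_norm_conj w 1

theorem cyclen_conj_le (w h : FreeGroup (Fin N)) : cyclen (h * w * h⁻¹) ≤ cyclen w := by
  obtain ⟨g, hg⟩ := exists_norm_conj_eq_cyclen w
  rw [← hg]
  convert cyclen_le_norm_conj (h * w * h⁻¹) (g * h⁻¹) using 2
  group

theorem cyclen_conj (w h : FreeGroup (Fin N)) : cyclen (h * w * h⁻¹) = cyclen w := by
  refine (cyclen_conj_le w h).antisymm ?_
  have := cyclen_conj_le (h * w * h⁻¹) h⁻¹
  rwa [show h⁻¹ * (h * w * h⁻¹) * h⁻¹⁻¹ = w by group] at this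

theorem cyclen_pos {w : FreeGroup (Fin N)} (hw : w ≠ 1) : 0 < cyclen w := by
  obtain ⟨g, hg⟩ := exists_norm_conj_eq_cyclen w
  rw [← hg, Nat.pos_iff_ne_zero, Ne, norm_eq_zero, conj_eq_one_iff]
  exact hw

theorem norm_le_cyclen_add (w : FreeGroup (Fin N)) : norm w ≤ cyclen w + 2 * lcp w w⁻¹ := by
  obtain ⟨g, hg⟩ := exists_norm_conj_eq_cyclen w
  rw [← hg]
  exact norm_le_norm_conj_add w g

theorem cyclen_map_le {ρ : FreeGroup (Fin N) →* FreeGroup (Fin N)} {K : ℕ}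
    (hK : ∀ i, norm (ρ (of i)) ≤ K) (w : FreeGroup (Fin N)) :
    cyclen (ρ w) ≤ K * cyclen w := by
  obtain ⟨h, hh⟩ := exists_norm_conj_eq_cyclen w
  have := norm_map_le_mul hK (h * w * h⁻¹)
  rw [hh] at this
  refine le_trans ?_ this
  rw [_root_.map_mul, _root_.map_mul, _root_.map_inv]
  exact cyclen_le_norm_conj _ _

/-- Cyclically reduced lengths on a sphere are bounded below by lengths on the previous one. -/
theorem exists_sum_norm_sub_le_sum_cyclen (hN : 2 ≤ N) (ρ : MulAut (FreeGroup (Fin N))) :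
    ∃ C : ℝ, 0 ≤ C ∧ ∀ n : ℕ, ∑ w ∈ sphere (Fin N) (n + 1), ((norm (ρ w) : ℝ) - C) ≤
      ∑ u ∈ sphere (Fin N) (n + 2), (cyclen (ρ u) : ℝ) := by
  have hbd : ∀ σ : MulAut (FreeGroup (Fin N)), ∃ K, ∀ i, norm (σ (of i)) ≤ K := fun σ =>
    ⟨∑ i, norm (σ (of i)), fun i => Finset.single_le_sum (f := fun i => norm (σ (of i)))
      (fun _ _ => Nat.zero_le _) (Finset.mem_univ i)⟩
  obtain ⟨K, hK⟩ := hbd ρ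
  obtain ⟨K', hK'⟩ := hbd ρ.symm
  have hK'' : ∀ w, norm w ≤ K' * norm (ρ.toMonoidHom w) := by
    intro w
    have := norm_map_le_mul (f := ρ.symm.toMonoidHom) hK' (ρ w)
    rwa [show ρ.symm.toMonoidHom (ρ w) = w from ρ.symm_apply_apply w] at this
  set B : ℕ := K * (K' * (2 * K)) + K
  refine ⟨(2 * B + K : ℕ), Nat.cast_nonneg _, fun n => ?_⟩
  rw [sum_sphere_succ (fun u => (cyclen (ρ u) : ℝ)) (n + 1)]
  refine Finset.sum_le_sum fun w hw => ?_
  have hw1 : w ≠ 1 := by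
    rintro rfl
    simp at hw
  obtain ⟨a, ha, ha'⟩ := exists_letter_cyclically_reduced (by simpa using hN) hw1
  have h1 := lcp_map_le_of_lcp_eq_zero (ρ := ρ.toMonoidHom) hK hK'' ha'
  have h2 := norm_le_cyclen_add (ρ (w * mk [a]))
  have h3 : norm (ρ w) ≤ norm (ρ (w * mk [a])) + K := by
    have h4 := norm_mul_le_norm_add (ρ w) (ρ (mk [a]))
    have h5 := norm_map_le_mul (f := ρ.toMonoidHom) hK (mk [a])
    rw [norm_mk_singleton, mul_one] at h5
    rw [_root_.map_mul]
    exact h4.trans (Nat.add_le_add_left h5 _)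
  have h6 : lcp (ρ (w * mk [a])) (ρ (w * mk [a]))⁻¹ ≤ B := by
    rw [← _root_.map_inv]
    exact h1
  have h7 : norm (ρ w) ≤ cyclen (ρ (w * mk [a])) + (2 * B + K) := by omega
  have h8 : (norm (ρ w) : ℝ) - (2 * B + K : ℕ) ≤ cyclen (ρ (w * mk [a])) := by
    rw [sub_le_iff_le_add]
    exact_mod_cast h7
  refine h8.trans ?_
  have := Finset.single_le_sum (s := Finset.univ)
    (f := fun a : Fin N × Bool =>
      if w⁻¹.toWord.head? = some a then 0 else (cyclen (ρ (w * mk [a])) : ℝ))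
    (fun a _ => by split_ifs <;> positivity) (Finset.mem_univ a)
  simpa only [if_neg ha] using this

end FreeGroup

namespace FreeGroup

variable {N : ℕ}

/-- Every automorphism is conjugate to one that cannot be shortened further. -/
theorem exists_isEnergyMinimal (φ : MulAut (FreeGroup (Fin N))) :
    ∃ ρ : MulAut (FreeGroup (Fin N)), (IsEnergyMinimal fun i => ρ (of i)) ∧
      ∀ w, cyclen (ρ w) = cyclen (φ w) := by
  set energy : FreeGroup (Fin N) → ℕ := fun p => ∑ i, norm (p⁻¹ * φ (of i) * p) ^ 2
  set p := Function.argmin energy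
  have happ : ∀ w, (MulAut.conj p⁻¹ * φ) w = p⁻¹ * φ w * p := fun w => by simp
  refine ⟨MulAut.conj p⁻¹ * φ, fun e _ => ?_, fun w => ?_⟩
  · have h := Function.argmin_le energy (p * e)
    have e' : ∀ i, e⁻¹ * (p⁻¹ * φ (of i) * p) * e = (p * e)⁻¹ * φ (of i) * (p * e) := fun i => by
      group
    simp only [happ, e']
    exact h
  · rw [happ]
    simpa using cyclen_conj (φ w) p⁻¹

theorem cyclen_ratio_le {φ : FreeGroup (Fin N) → FreeGroup (Fin N)} {K : ℝ}
    (hK : ∀ w, (cyclen (φ w) : ℝ) ≤ K * cyclen w) (w : {w : FreeGroup (Fin N) // w ≠ 1}) :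
    (cyclen (φ w.1) : ℝ) / (cyclen w.1 : ℝ) ≤ K := by
  have : (0 : ℝ) < cyclen w.1 := by exact_mod_cast cyclen_pos w.2
  rw [div_le_iff₀ this]
  exact hK w.1

theorem LambdaA_le {φ : FreeGroup (Fin N) → FreeGroup (Fin N)} {K : ℝ} (hN : 2 ≤ N)
    (hK : ∀ w, (cyclen (φ w) : ℝ) ≤ K * cyclen w) : LambdaA φ ≤ K := by
  have : Nonempty {w : FreeGroup (Fin N) // w ≠ 1} := ⟨⟨of ⟨0, by omega⟩, of_ne_one _⟩⟩
  exact ciSup_le (cyclen_ratio_le hK)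

theorem cyclen_div_le_LambdaA {φ : FreeGroup (Fin N) → FreeGroup (Fin N)} {K : ℝ}
    (hK : ∀ w, (cyclen (φ w) : ℝ) ≤ K * cyclen w) {w : FreeGroup (Fin N)} (hw : w ≠ 1) :
    (cyclen (φ w) : ℝ) / (cyclen w : ℝ) ≤ LambdaA φ :=
  le_ciSup (f := fun w : {w : FreeGroup (Fin N) // w ≠ 1} =>
      (cyclen (φ w.1) : ℝ) / (cyclen w.1 : ℝ))
    ⟨K, by rintro _ ⟨w, rfl⟩; exact cyclen_ratio_le hK w⟩ ⟨w, hw⟩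

theorem avg_succ (hN : 2 ≤ N) (φ : FreeGroup (Fin N) → FreeGroup (Fin N)) (n : ℕ) :
    avg N φ (n + 1) = (∑ w ∈ sphere (Fin N) (n + 1), (cyclen (φ w) : ℝ)) /
      ((n + 1 : ℕ) * (sphere (Fin N) (n + 1)).card) := by
  have h1 : (∑' w : {w : FreeGroup (Fin N) // wlen w = n + 1}, (cyclen (φ w.1) : ℝ)) =
      ∑ w ∈ sphere (Fin N) (n + 1), (cyclen (φ w) : ℝ) := by
    rw [← Finset.tsum_subtype (sphere (Fin N) (n + 1)) fun w => (cyclen (φ w) : ℝ)]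
    exact (Equiv.subtypeEquivRight fun w => (mem_sphere (w := w)).symm).tsum_eq
      (fun w : {w // w ∈ sphere (Fin N) (n + 1)} => (cyclen (φ w.1) : ℝ))
  rw [avg, h1, card_sphere_succ, Nat.add_sub_cancel, Fintype.card_fin]
  congr 2
  rw [Nat.cast_mul, Nat.cast_pow, Nat.cast_sub (by omega)]
  push_cast
  ring

theorem avg_le (hN : 2 ≤ N) {φ : FreeGroup (Fin N) → FreeGroup (Fin N)} {K : ℝ} (hK0 : 0 ≤ K)
    (hK : ∀ w, (cyclen (φ w) : ℝ) ≤ K * cyclen w) {n : ℕ} (hn : 1 ≤ n) : avg N φ n ≤ K := by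
  obtain ⟨n, rfl⟩ := Nat.exists_eq_add_of_le' hn
  have hS := card_sphere_succ_pos (ι := Fin N) (by simpa using hN) n
  rw [avg_succ hN, div_le_iff₀ (by positivity)]
  calc ∑ w ∈ sphere (Fin N) (n + 1), (cyclen (φ w) : ℝ)
      ≤ ∑ w ∈ sphere (Fin N) (n + 1), K * (n + 1 : ℕ) := by
        refine Finset.sum_le_sum fun w hw => (hK w).trans ?_
        have : cyclen w ≤ n + 1 := (cyclen_le_norm w).trans (mem_sphere.1 hw).le
        exact mul_le_mul_of_nonneg_left (by exact_mod_cast this) hK0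
    _ = K * ((n + 1 : ℕ) * (sphere (Fin N) (n + 1)).card) := by
        rw [Finset.sum_const, nsmul_eq_mul]
        ring

theorem avg_nonneg (φ : FreeGroup (Fin N) → FreeGroup (Fin N)) (n : ℕ) : 0 ≤ avg N φ n :=
  div_nonneg (tsum_nonneg fun _ => Nat.cast_nonneg _) (by positivity)

/-- The lower bound for averages of cyclically reduced lengths. -/
theorem exists_eventually_mul_LambdaA_le_avg (hN : 2 ≤ N) : ∃ τ : ℝ, 0 < τ ∧
    ∀ φ : MulAut (FreeGroup (Fin N)), ∀ᶠ n in Filter.atTop,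
      τ * LambdaA (fun w => φ w) ≤ avg N (fun w => φ w) n := by
  have hcard : 2 ≤ Fintype.card (Fin N) := by simpa using hN
  have hN' : (2 : ℝ) ≤ Fintype.card (Fin N) := by exact_mod_cast hcard
  obtain ⟨c, hc, H⟩ := exists_mul_le_sphereMean hcard
  set q : ℝ := 2 * Fintype.card (Fin N) - 1 with hq
  have hq0 : 0 < q := by linarith
  refine ⟨c / (2 * q), by positivity, fun φ => ?_⟩
  obtain ⟨ρ, hρ, hcyc⟩ := exists_isEnergyMinimal φ
  have : Nonempty (Fin N) := ⟨⟨0, by omega⟩⟩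
  obtain ⟨b, hb⟩ := Finite.exists_max fun i => norm (ρ (of i))
  obtain ⟨C, hC, hsum⟩ := exists_sum_norm_sub_le_sum_cyclen hN ρ
  set D : ℝ := (norm (ρ (of b)) : ℝ) with hD
  have hD0 : 0 < D := by
    have : 0 < norm (ρ (of b)) := by
      rw [Nat.pos_iff_ne_zero, Ne, norm_eq_zero]
      exact (map_ne_one_iff ρ ρ.injective).2 (of_ne_one b)
    rw [hD]
    exact_mod_cast this
  have hΛ : LambdaA (fun w => φ w) ≤ D := by
    refine LambdaA_le hN fun w => ?_
    rw [← hcyc]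
    rw [hD]
    exact_mod_cast cyclen_map_le (ρ := ρ.toMonoidHom) hb w
  have hlim : ∀ᶠ n : ℕ in Filter.atTop, 2 * C + 18 * (c * D) ≤ c * D * n :=
    (tendsto_natCast_atTop_atTop.const_mul_atTop (by positivity)).eventually_ge_atTop _
  obtain ⟨n₀, hn₀⟩ := Filter.eventually_atTop.1 hlim
  filter_upwards [Filter.eventually_ge_atTop (n₀ + 18)] with m hm
  obtain ⟨n, rfl⟩ := Nat.exists_eq_add_of_le' (show 18 ≤ m by omega)
  have hn := hn₀ n (by omega)
  have hS := card_sphere_succ_pos hcard (n + 16)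
  have hSS := card_sphere_succ_succ (α := Fin N) (n + 16)
  have hmean := H ρ hρ b hb n
  have hs := hsum (n + 16)
  rw [Finset.sum_sub_distrib, Finset.sum_const, nsmul_eq_mul] at hs
  rw [sphereMean, le_div_iff₀ hS] at hmean
  rw [show n + 18 = n + 17 + 1 by omega, avg_succ hN]
  simp only [← hcyc]
  rw [show n + 16 + 1 = n + 17 by omega, show n + 16 + 2 = n + 17 + 1 by omega] at *
  rw [hSS, le_div_iff₀ (by positivity)]
  refine le_trans ?_ hs
  set S : ℝ := ((sphere (Fin N) (n + 17)).card : ℝ)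
  calc c / (2 * q) * LambdaA (fun w => φ w) * ((n + 17 + 1 : ℕ) * (q * S))
      ≤ c / (2 * q) * D * ((n + 17 + 1 : ℕ) * (q * S)) := by gcongr
    _ = c * D * (n + 18) / 2 * S := by
        push_cast
        field_simp
        ring
    _ ≤ (c * D * n - C) * S := by
        refine mul_le_mul_of_nonneg_right ?_ hS.le
        linarith
    _ ≤ _ := by
        rw [sub_mul]
        linarith

end FreeGroup

/-- for every `N ≥ 2` there is `τ_N ∈ (0,1]` such that for every
automorphism `φ` of `F_N`: `τ_N·Λ_A(φ) ≤ liminf_n avg_n(φ)`, `avg_n(φ) ≤ Λ_A(φ)` for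
every `n ≥ 1`, and in particular `0 < τ_N ≤ λ_A(φ)/Λ_A(φ) ≤ 1`. -/
theorem stmt8 (N : ℕ) (hN : 2 ≤ N) :
    ∃ τ : ℝ, 0 < τ ∧ τ ≤ 1 ∧ ∀ φ : MulAut (FreeGroup (Fin N)),
      τ * LambdaA (fun w => φ w) ≤ Filter.liminf (avg N (fun w => φ w)) Filter.atTop ∧
      (∀ n : ℕ, 1 ≤ n → avg N (fun w => φ w) n ≤ LambdaA (fun w => φ w)) ∧
      τ ≤ lamA N (fun w => φ w) / LambdaA (fun w => φ w) ∧
      lamA N (fun w => φ w) / LambdaA (fun w => φ w) ≤ 1 := by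
  obtain ⟨τ, hτ, H⟩ := FreeGroup.exists_eventually_mul_LambdaA_le_avg hN
  refine ⟨min τ 1, lt_min hτ one_pos, min_le_right _ _, fun φ => ?_⟩
  set Λ := LambdaA (fun w => φ w) with hΛ
  obtain ⟨K, hK⟩ : ∃ K : ℝ, ∀ w, (cyclen (φ w) : ℝ) ≤ K * cyclen w := by
    refine ⟨(∑ i, FreeGroup.norm (φ (FreeGroup.of i)) : ℕ), fun w => ?_⟩
    exact_mod_cast FreeGroup.cyclen_map_le (ρ := φ.toMonoidHom) (fun i =>
      Finset.single_le_sum (f := fun i => FreeGroup.norm (φ (FreeGroup.of i)))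
        (fun _ _ => Nat.zero_le _) (Finset.mem_univ i)) w
  have hΛ0 : 0 < Λ := by
    have h1 : (FreeGroup.of ⟨0, by omega⟩ : FreeGroup (Fin N)) ≠ 1 := FreeGroup.of_ne_one _
    refine lt_of_lt_of_le ?_ (FreeGroup.cyclen_div_le_LambdaA hK h1)
    have h2 := FreeGroup.cyclen_pos h1
    have h3 := FreeGroup.cyclen_pos ((map_ne_one_iff φ φ.injective).2 h1)
    positivity
  have hΛw : ∀ w, (cyclen (φ w) : ℝ) ≤ Λ * cyclen w := by
    intro w
    by_cases hw : w = 1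
    · have : cyclen (φ w) = 0 := by
        have := FreeGroup.cyclen_le_norm (φ w)
        rw [hw, map_one, FreeGroup.norm_one] at this
        rw [hw, map_one]
        omega
      rw [this, Nat.cast_zero]
      exact mul_nonneg hΛ0.le (Nat.cast_nonneg _)
    · have h := FreeGroup.cyclen_div_le_LambdaA hK hw
      rwa [div_le_iff₀ (by exact_mod_cast FreeGroup.cyclen_pos hw)] at h
  have havg : ∀ n, 1 ≤ n → avg N (fun w => φ w) n ≤ Λ := fun n hn =>
    FreeGroup.avg_le hN hΛ0.le hΛw hn
  have hup : ∀ᶠ n in Filter.atTop, avg N (fun w => φ w) n ≤ Λ :=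
    Filter.eventually_atTop.2 ⟨1, havg⟩
  have hbdd : Filter.IsBoundedUnder (· ≤ ·) Filter.atTop (avg N (fun w => φ w)) := ⟨Λ, hup⟩
  have hbdd' : Filter.IsBoundedUnder (· ≥ ·) Filter.atTop (avg N (fun w => φ w)) :=
    Filter.isBoundedUnder_of ⟨0, FreeGroup.avg_nonneg _⟩
  have hlow : min τ 1 * Λ ≤ Filter.liminf (avg N (fun w => φ w)) Filter.atTop := by
    refine Filter.le_liminf_of_le hbdd.isCoboundedUnder_ge ?_
    filter_upwards [H φ] with n hn
    exact (mul_le_mul_of_nonneg_right (min_le_left _ _) hΛ0.le).trans hn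
  refine ⟨hlow, havg, ?_, ?_⟩
  · rw [le_div_iff₀ hΛ0]
    exact hlow.trans (Filter.liminf_le_limsup hbdd hbdd')
  · rw [div_le_one hΛ0]
    exact Filter.limsup_le_of_le hbdd'.isCoboundedUnder_le hup
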